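/- Let d ≥ 3, let 1 ≤ p < d/2, and let q > dp/(d−p). There exists a constant κ ∈ (0,∞), depending only on p, q, d and the norm, such that for every probability measure μ on ℝ^d, E[ρ_p^p(μ, μ̂_N)]^{1/p} ≤ κ · (∫_{ℝ^d} ‖x‖^q dμ(x))^{1/q} · N^{−1/d} for all N ≥ 1, where μ̂_N is the empirical measure of N i.i.d. μ-distributed samples. -/

import Mathlib

open MeasureTheory ENNReal

/-- The set of couplings (transports) between two measures on `ℝ^d`. -/
def couplings {d : ℕ} (μ ν : Measure (Fin d → ℝ)) :
    Set (Measure ((Fin d → ℝ) × (Fin d → ℝ))) :=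
  {ξ | ξ.map Prod.fst = μ ∧ ξ.map Prod.snd = ν}

/-- `ρ_p^p(μ,ν)`: the `p`-th power of the `p`-th Wasserstein metric. -/
noncomputable def WpPow {d : ℕ} (p : ℝ) (μ ν : Measure (Fin d → ℝ)) : ℝ≥0∞ :=
  ⨅ ξ ∈ couplings μ ν, ∫⁻ z, (‖z.1 - z.2‖₊ : ℝ≥0∞) ^ p ∂ξ

/-- The empirical measure `(1/N) ∑_{j<N} δ_{x_j}` of a vector of `N` points. -/
noncomputable def empMeas {d : ℕ} (N : ℕ) (x : Fin N → (Fin d → ℝ)) :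
    Measure (Fin d → ℝ) :=
  (N : ℝ≥0∞)⁻¹ • ∑ j, Measure.dirac (x j)

/-- `E[ρ_p^p(μ, μ̂_N)]`: the expected `p`-th power Wasserstein distance between `μ`
and the empirical measure of `N` i.i.d. `μ`-distributed samples (modelled on the
canonical product space). -/
noncomputable def expWpPow {d : ℕ} (p : ℝ) (μ : Measure (Fin d → ℝ)) (N : ℕ) :
    ℝ≥0∞ :=
  ∫⁻ x, WpPow p μ (empMeas N x) ∂(Measure.pi fun _ : Fin N => μ)

/-- The unit cube `[0,1)^d`. -/
def unitBox (d : ℕ) : Set (Fin d → ℝ) := Set.univ.pi fun _ => Set.Ico (0 : ℝ) 1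

/-- One matching step: inside every cell `f ⁻¹' {i}` the common mass of `μ` and `ν` is coupled,
leaving only the excess of either measure. -/
lemma exists_cellwise_partial_coupling {E ι : Type*} [MeasurableSpace E] [Countable ι]
    [MeasurableSpace ι] [DiscreteMeasurableSpace ι] {f : E → ι} (hf : Measurable f)
    (μ ν : Measure E) [IsFiniteMeasure μ] [IsFiniteMeasure ν] :
    ∃ (ξ : Measure (E × E)) (μ' ν' : Measure E),
      ξ.map Prod.fst + μ' = μ ∧ ξ.map Prod.snd + ν' = ν ∧ (∀ᵐ z ∂ξ, f z.1 = f z.2) ∧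
      (∀ i, μ' (f ⁻¹' {i}) = μ (f ⁻¹' {i}) - ν (f ⁻¹' {i})) ∧
      (∀ i, ν' (f ⁻¹' {i}) = ν (f ⁻¹' {i}) - μ (f ⁻¹' {i})) := by
  have hm : ∀ i, MeasurableSet (f ⁻¹' {i}) := fun i => hf (measurableSet_singleton i)
  have hdisj : Pairwise (Function.onFun Disjoint fun i => f ⁻¹' {i}) := by
    intro i j hij
    exact Disjoint.preimage f (by simpa using hij)
  have hU : (⋃ i, f ⁻¹' {i}) = Set.univ := by
    ext x; simp
  have hdecomp : ∀ (ρ : Measure E), Measure.sum (fun i => ρ.restrict (f ⁻¹' {i})) = ρ := by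
    intro ρ
    rw [← Measure.restrict_iUnion hdisj hm, hU, Measure.restrict_univ]
  have hcell : ∀ (ρ : Measure E) (w : ι → ℝ≥0∞) (i : ι),
      Measure.sum (fun j => w j • ρ.restrict (f ⁻¹' {j})) (f ⁻¹' {i})
        = w i * ρ (f ⁻¹' {i}) := by
    intro ρ w i
    rw [Measure.sum_apply _ (hm i), tsum_eq_single i]
    · simp [Measure.restrict_apply (hm i)]
    · intro j hj
      rw [Measure.smul_apply, Measure.restrict_apply (hm i), (hdisj hj.symm).inter_eq]
      simp
  set a : ι → ℝ≥0∞ := fun i => μ (f ⁻¹' {i}) with ha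
  set b : ι → ℝ≥0∞ := fun i => ν (f ⁻¹' {i}) with hb
  have ha_top : ∀ i, a i ≠ ∞ := fun i => measure_ne_top _ _
  have hb_top : ∀ i, b i ≠ ∞ := fun i => measure_ne_top _ _
  have key : ∀ s t : ℝ≥0∞, s ≠ ∞ → t ≠ ∞ → (1 - t * (max s t)⁻¹) * s = s - t := by
    intro s t hs ht
    rcases le_total s t with h | h
    · rw [max_eq_right h, tsub_eq_zero_of_le h]
      rcases eq_or_ne t 0 with rfl | h0
      · have : s = 0 := le_antisymm h bot_le
        simp [this]
      · rw [ENNReal.mul_inv_cancel h0 ht]; simp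
    · rw [max_eq_left h]
      rcases eq_or_ne s 0 with rfl | h0
      · simp
      · rw [ENNReal.sub_mul (fun _ _ => hs), one_mul, mul_assoc, ENNReal.inv_mul_cancel h0 hs,
          mul_one]
  have le1 : ∀ s t : ℝ≥0∞, t * (max s t)⁻¹ ≤ 1 := by
    intro s t
    rw [← div_eq_mul_inv]
    exact ENNReal.div_le_of_le_mul (by simp)
  have hsplit : ∀ (ρ : Measure E) (w : ι → ℝ≥0∞), (∀ i, w i ≤ 1) →
      Measure.sum (fun i => w i • ρ.restrict (f ⁻¹' {i})) +
        Measure.sum (fun i => (1 - w i) • ρ.restrict (f ⁻¹' {i})) = ρ := by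
    intro ρ w hw
    rw [Measure.sum_add_sum]
    conv_rhs => rw [← hdecomp ρ]
    congr 1
    ext1 i
    rw [← add_smul, add_tsub_cancel_of_le (hw i), one_smul]
  refine ⟨Measure.sum fun i =>
      (max (a i) (b i))⁻¹ • (μ.restrict (f ⁻¹' {i})).prod (ν.restrict (f ⁻¹' {i})),
    Measure.sum fun i => (1 - b i * (max (a i) (b i))⁻¹) • μ.restrict (f ⁻¹' {i}),
    Measure.sum fun i => (1 - a i * (max (b i) (a i))⁻¹) • ν.restrict (f ⁻¹' {i}),
    ?_, ?_, ?_, ?_, ?_⟩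
  · conv_rhs => rw [← hsplit μ (fun i => b i * (max (a i) (b i))⁻¹) (fun i => le1 _ _)]
    congr 1
    rw [Measure.map_sum measurable_fst.aemeasurable]
    congr 1
    ext1 i
    rw [Measure.map_smul, Measure.map_fst_prod, smul_smul, Measure.restrict_apply_univ, mul_comm]
  · conv_rhs => rw [← hsplit ν (fun i => a i * (max (b i) (a i))⁻¹) (fun i => le1 _ _)]
    congr 1
    rw [Measure.map_sum measurable_snd.aemeasurable]
    congr 1
    ext1 i
    rw [Measure.map_smul, Measure.map_snd_prod, smul_smul, Measure.restrict_apply_univ, mul_comm,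
      max_comm]
  · rw [Measure.ae_sum_iff]
    intro i
    apply Measure.ae_smul_measure
    rw [Measure.prod_restrict]
    filter_upwards [ae_restrict_mem ((hm i).prod (hm i))] with z hz
    have h1 : f z.1 = i := hz.1
    have h2 : f z.2 = i := hz.2
    rw [h1, h2]
  · intro i
    rw [hcell μ (fun i => 1 - b i * (max (a i) (b i))⁻¹) i]
    exact key _ _ (ha_top i) (hb_top i)
  · intro i
    rw [hcell ν (fun i => 1 - a i * (max (b i) (a i))⁻¹) i]
    exact key _ _ (hb_top i) (ha_top i)

lemma lintegral_comp_eq_tsum_fiber {E ι : Type*} [MeasurableSpace E] [Countable ι]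
    [MeasurableSpace ι] [DiscreteMeasurableSpace ι] {f : E → ι} (hf : Measurable f)
    (μ : Measure E) (h : ι → ℝ≥0∞) :
    ∫⁻ x, h (f x) ∂μ = ∑' i, h i * μ (f ⁻¹' {i}) := by
  rw [← lintegral_map (measurable_of_countable h) hf, lintegral_countable']
  congr 1
  ext1 i
  rw [Measure.map_apply hf (measurableSet_singleton i)]

lemma lintegral_le_of_ae_fiber_eq {E ι : Type*} [MeasurableSpace E] [Countable ι]
    [MeasurableSpace ι] [DiscreteMeasurableSpace ι] {f g : E → ι} (hg : Measurable g)
    {c : E → E → ℝ≥0∞} {h : ι → ℝ≥0∞}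
    (hc : ∀ x y, f x = f y → c x y ≤ h (g x) + h (g y)) {ξ : Measure (E × E)}
    (hξ : ∀ᵐ z ∂ξ, f z.1 = f z.2) :
    ∫⁻ z, c z.1 z.2 ∂ξ ≤
      ∫⁻ x, h (g x) ∂(ξ.map Prod.fst) + ∫⁻ x, h (g x) ∂(ξ.map Prod.snd) := by
  have hm : Measurable fun x => h (g x) := (measurable_of_countable h).comp hg
  rw [lintegral_map hm measurable_fst, lintegral_map hm measurable_snd,
    ← lintegral_add_left (f := fun z : E × E => h (g z.1)) (hm.comp measurable_fst)]
  refine lintegral_mono_ae ?_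
  filter_upwards [hξ] with z hz
  exact hc _ _ hz

/-- Matching the cells of a refining sequence of partitions from the finest one upwards. -/
lemma exists_hierarchical_partial_coupling {E ι : Type*} [MeasurableSpace E] [Countable ι]
    [MeasurableSpace ι] [DiscreteMeasurableSpace ι] (c : E → E → ℝ≥0∞)
    (μ ν : Measure E) [IsFiniteMeasure μ] [IsFiniteMeasure ν] (L : ℕ) :
    ∀ (f : ℕ → E → ι) (h : ℕ → ι → ℝ≥0∞), (∀ l, Measurable (f l)) →
      (∀ l x y, f (l + 1) x = f (l + 1) y → f l x = f l y) →
      (∀ l x y, f l x = f l y → c x y ≤ h l (f (l + 1) x) + h l (f (l + 1) y)) →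
    ∃ (ξ : Measure (E × E)) (μ' ν' : Measure E),
      ξ.map Prod.fst + μ' = μ ∧ ξ.map Prod.snd + ν' = ν ∧ (∀ᵐ z ∂ξ, f 0 z.1 = f 0 z.2) ∧
      (∀ i, μ' (f 0 ⁻¹' {i}) = μ (f 0 ⁻¹' {i}) - ν (f 0 ⁻¹' {i})) ∧
      (∀ i, ν' (f 0 ⁻¹' {i}) = ν (f 0 ⁻¹' {i}) - μ (f 0 ⁻¹' {i})) ∧
      ∫⁻ z, c z.1 z.2 ∂ξ ≤
        (∫⁻ x, h L (f (L + 1) x) ∂μ + ∫⁻ x, h L (f (L + 1) x) ∂ν) +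
        ∑ l ∈ Finset.range L, ∑' i, h l i *
          ((μ (f (l + 1) ⁻¹' {i}) - ν (f (l + 1) ⁻¹' {i})) +
            (ν (f (l + 1) ⁻¹' {i}) - μ (f (l + 1) ⁻¹' {i}))) := by
  induction L with
  | zero =>
    intro f h hf _ hc
    obtain ⟨ξ, μ', ν', h1, h2, h3, h4, h5⟩ := exists_cellwise_partial_coupling (hf 0) μ ν
    refine ⟨ξ, μ', ν', h1, h2, h3, h4, h5, ?_⟩
    have := lintegral_le_of_ae_fiber_eq (hf 1) (hc 0) h3
    simp only [Finset.range_zero, Finset.sum_empty, add_zero, zero_add]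
    refine this.trans (add_le_add (lintegral_mono' ?_ le_rfl) (lintegral_mono' ?_ le_rfl))
    · conv_rhs => rw [← h1]
      exact Measure.le_add_right le_rfl
    · conv_rhs => rw [← h2]
      exact Measure.le_add_right le_rfl
  | succ L ih =>
    intro f h hf hn hc
    obtain ⟨ξ₁, μ₁, ν₁, h1, h2, h3, h4, h5, h6⟩ := ih (fun l => f (l + 1)) (fun l => h (l + 1))
      (fun l => hf _) (fun l => hn _) (fun l => hc _)
    have hμ₁ : μ₁ ≤ μ := by
      conv_rhs => rw [← h1]
      exact Measure.le_add_left le_rfl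
    have hν₁ : ν₁ ≤ ν := by
      conv_rhs => rw [← h2]
      exact Measure.le_add_left le_rfl
    have : IsFiniteMeasure μ₁ := isFiniteMeasure_of_le μ hμ₁
    have : IsFiniteMeasure ν₁ := isFiniteMeasure_of_le ν hν₁
    obtain ⟨ξ₂, μ₂, ν₂, g1, g2, g3, g4, g5⟩ := exists_cellwise_partial_coupling (hf 0) μ₁ ν₁
    have h3' : ∀ᵐ z ∂ξ₁, f 0 z.1 = f 0 z.2 := by
      filter_upwards [h3] with z hz using hn 0 _ _ hz
    have hm : ∀ i, MeasurableSet (f 0 ⁻¹' {i}) := fun i => hf 0 (measurableSet_singleton i)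
    have heq : ∀ i, ξ₁.map Prod.fst (f 0 ⁻¹' {i}) = ξ₁.map Prod.snd (f 0 ⁻¹' {i}) := by
      intro i
      rw [Measure.map_apply measurable_fst (hm i), Measure.map_apply measurable_snd (hm i)]
      refine measure_congr ?_
      filter_upwards [h3'] with z hz
      apply propext
      change f 0 z.1 = i ↔ f 0 z.2 = i
      rw [hz]
    have hfin : ∀ i, ξ₁.map Prod.snd (f 0 ⁻¹' {i}) ≠ ∞ := by
      intro i
      refine ne_top_of_le_ne_top (measure_ne_top ν (f 0 ⁻¹' {i})) ?_
      conv_rhs => rw [← h2]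
      simp
    have hμi : ∀ i, μ (f 0 ⁻¹' {i}) = ξ₁.map Prod.snd (f 0 ⁻¹' {i}) + μ₁ (f 0 ⁻¹' {i}) := by
      intro i
      rw [← heq]
      conv_lhs => rw [← h1]
      simp
    have hνi : ∀ i, ν (f 0 ⁻¹' {i}) = ξ₁.map Prod.snd (f 0 ⁻¹' {i}) + ν₁ (f 0 ⁻¹' {i}) := by
      intro i
      conv_lhs => rw [← h2]
      simp
    refine ⟨ξ₁ + ξ₂, μ₂, ν₂, ?_, ?_, ?_, ?_, ?_, ?_⟩
    · rw [Measure.map_add _ _ measurable_fst, add_assoc, g1, h1]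
    · rw [Measure.map_add _ _ measurable_snd, add_assoc, g2, h2]
    · rw [ae_add_measure_iff]
      exact ⟨h3', g3⟩
    · intro i
      rw [g4, hμi, hνi, ENNReal.add_sub_add_eq_sub_left (hfin i)]
    · intro i
      rw [g5, hμi, hνi, ENNReal.add_sub_add_eq_sub_left (hfin i)]
    · rw [lintegral_add_measure, Finset.sum_range_succ', ← add_assoc]
      refine add_le_add h6 ?_
      refine (lintegral_le_of_ae_fiber_eq (hf 1) (hc 0) g3).trans ?_
      have e1 : ξ₂.map Prod.fst ≤ μ₁ := by
        conv_rhs => rw [← g1]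
        exact Measure.le_add_right le_rfl
      have e2 : ξ₂.map Prod.snd ≤ ν₁ := by
        conv_rhs => rw [← g2]
        exact Measure.le_add_right le_rfl
      refine (add_le_add (lintegral_mono' e1 le_rfl) (lintegral_mono' e2 le_rfl)).trans ?_
      rw [lintegral_comp_eq_tsum_fiber (hf 1), lintegral_comp_eq_tsum_fiber (hf 1),
        ← ENNReal.tsum_add]
      refine ENNReal.tsum_le_tsum fun i => ?_
      rw [h4, h5, mul_add]

/-- The transport cost is controlled by the cell discrepancies along a refining sequence of
partitions starting from the trivial one. -/
lemma WpPow_le_hierarchical {d : ℕ} {ι : Type*} [Countable ι]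
    [MeasurableSpace ι] [DiscreteMeasurableSpace ι] (p : ℝ)
    (μ ν : Measure (Fin d → ℝ)) [IsProbabilityMeasure μ] [IsProbabilityMeasure ν] (L : ℕ)
    (f : ℕ → (Fin d → ℝ) → ι) (h : ℕ → ι → ℝ≥0∞) (hf : ∀ l, Measurable (f l))
    (hn : ∀ l x y, f (l + 1) x = f (l + 1) y → f l x = f l y)
    (hc : ∀ l x y, f l x = f l y →
      (‖x - y‖₊ : ℝ≥0∞) ^ p ≤ h l (f (l + 1) x) + h l (f (l + 1) y))
    (i₀ : ι) (hf0 : ∀ x, f 0 x = i₀) :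
    WpPow p μ ν ≤
      (∫⁻ x, h L (f (L + 1) x) ∂μ + ∫⁻ x, h L (f (L + 1) x) ∂ν) +
        ∑ l ∈ Finset.range L, ∑' i, h l i *
          ((μ (f (l + 1) ⁻¹' {i}) - ν (f (l + 1) ⁻¹' {i})) +
            (ν (f (l + 1) ⁻¹' {i}) - μ (f (l + 1) ⁻¹' {i}))) := by
  obtain ⟨ξ, μ', ν', h1, h2, -, h4, h5, h6⟩ := exists_hierarchical_partial_coupling
    (fun x y => (‖x - y‖₊ : ℝ≥0∞) ^ p) μ ν L f h hf hn hc
  have hU : f 0 ⁻¹' {i₀} = Set.univ := by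
    ext x; simp [hf0]
  have hμ' : μ' = 0 := by
    have := h4 i₀
    rw [hU] at this
    simpa using this
  have hν' : ν' = 0 := by
    have := h5 i₀
    rw [hU] at this
    simpa using this
  subst hμ' hν'
  rw [add_zero] at h1 h2
  exact (iInf₂_le ξ ⟨h1, h2⟩).trans h6

/-- The index of the dyadic ring (of inner scale `r`) containing `x`. -/
noncomputable def ringIdx {d : ℕ} (r : ℝ) (x : Fin d → ℝ) : ℕ := ⌈Real.logb 2 (‖x‖ / r)⌉₊

/-- Refining partitions of `ℝ^d`: the trivial one, followed by the dyadic subdivisions of all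
dyadic rings, where the mesh in each ring is proportional to its size. -/
noncomputable def dyadicCell {d : ℕ} (r : ℝ) : ℕ → (Fin d → ℝ) → ℕ × (Fin d → ℤ)
  | 0, _ => (0, 0)
  | l + 1, x => (ringIdx r x, fun i => ⌊2 ^ l * (x i / (2 ^ ringIdx r x * r))⌋)

lemma measurable_ringIdx {d : ℕ} (r : ℝ) : Measurable (ringIdx r : (Fin d → ℝ) → ℕ) := by
  unfold ringIdx
  refine Nat.measurable_ceil.comp ?_
  unfold Real.logb
  fun_prop

lemma measurable_dyadicCell {d : ℕ} (r : ℝ) (l : ℕ) :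
    Measurable (dyadicCell r l : (Fin d → ℝ) → ℕ × (Fin d → ℤ)) := by
  cases l with
  | zero => exact measurable_const
  | succ l =>
    refine (measurable_ringIdx r).prodMk (measurable_pi_lambda _ fun i => ?_)
    refine Int.measurable_floor.comp ?_
    have h2 : Measurable fun x : Fin d → ℝ => (2 : ℝ) ^ ringIdx r x :=
      (measurable_of_countable fun n : ℕ => (2 : ℝ) ^ n).comp (measurable_ringIdx r)
    fun_prop

lemma norm_le_two_pow_ringIdx {d : ℕ} {r : ℝ} (hr : 0 < r) (x : Fin d → ℝ) :
    ‖x‖ ≤ 2 ^ ringIdx r x * r := by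
  rcases (norm_nonneg x).eq_or_lt with h | h
  · rw [← h]; positivity
  · rw [← div_le_iff₀ hr, ← Real.rpow_natCast,
      ← Real.logb_le_iff_le_rpow one_lt_two (by positivity)]
    exact Nat.le_ceil _

lemma two_pow_ringIdx_le {d : ℕ} {r : ℝ} (hr : 0 < r) (x : Fin d → ℝ) :
    2 ^ ringIdx r x * r ≤ max r (2 * ‖x‖) := by
  rcases Nat.eq_zero_or_pos (ringIdx r x) with h | h
  · simp [h]
  · obtain ⟨n, hn⟩ : ∃ n, ringIdx r x = n + 1 := ⟨_, (Nat.succ_pred_eq_of_pos h).symm⟩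
    have h1 : (n : ℝ) < Real.logb 2 (‖x‖ / r) := Nat.lt_ceil.1 (by
      change n < ringIdx r x
      omega)
    have hx : 0 < ‖x‖ := by
      rcases (norm_nonneg x).eq_or_lt with h0 | h0
      · rw [← h0] at h1
        simp at h1
        have : (0 : ℝ) ≤ n := Nat.cast_nonneg n
        linarith
      · exact h0
    rw [Real.lt_logb_iff_rpow_lt one_lt_two (by positivity), Real.rpow_natCast,
      lt_div_iff₀ hr] at h1
    rw [hn, pow_succ]
    refine le_max_of_le_right ?_
    linarith

lemma dyadicCell_nested {d : ℕ} (r : ℝ) (l : ℕ) (x y : Fin d → ℝ)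
    (h : dyadicCell r (l + 1) x = dyadicCell r (l + 1) y) :
    dyadicCell r l x = dyadicCell r l y := by
  cases l with
  | zero => rfl
  | succ l =>
    have h1 : ringIdx r x = ringIdx r y := congrArg Prod.fst h
    have h2 := congrArg Prod.snd h
    refine Prod.ext h1 (funext fun i => ?_)
    have h3 := congrFun h2 i
    simp only [dyadicCell] at h3 ⊢
    have key : ∀ t : ℝ, ⌊2 ^ l * t⌋ = ⌊2 ^ (l + 1) * t⌋ / 2 := by
      intro t
      have := Int.floor_div_natCast (2 ^ (l + 1) * t) 2
      simp only [Nat.cast_ofNat] at this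
      rw [← this]
      congr 1
      ring
    rw [key, key, h3]

lemma norm_sub_le_of_dyadicCell_eq {d : ℕ} {r : ℝ} (hr : 0 < r) (l : ℕ) (x y : Fin d → ℝ)
    (h : dyadicCell r (l + 1) x = dyadicCell r (l + 1) y) :
    ‖x - y‖ ≤ 2 ^ ringIdx r x * r / 2 ^ l := by
  have h1 : ringIdx r x = ringIdx r y := congrArg Prod.fst h
  have h2 := congrArg Prod.snd h
  rw [pi_norm_le_iff_of_nonneg (by positivity)]
  intro i
  have h3 := congrFun h2 i
  simp only [dyadicCell] at h3
  rw [← h1] at h3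
  have h4 := (Int.abs_sub_lt_one_of_floor_eq_floor h3).le
  rw [← mul_sub, ← sub_div, abs_mul, abs_div, abs_of_pos (by positivity : (0 : ℝ) < 2 ^ l),
    abs_of_pos (by positivity : (0 : ℝ) < 2 ^ ringIdx r x * r), ← mul_div_assoc,
    div_le_one (by positivity)] at h4
  rw [Pi.sub_apply, Real.norm_eq_abs, le_div_iff₀ (by positivity)]
  linarith

/-- The cost of moving mass inside a cell of level `l` in a given ring. -/
noncomputable def cellCost {d : ℕ} (p r : ℝ) (l : ℕ) (i : ℕ × (Fin d → ℤ)) : ℝ≥0∞ :=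
  ENNReal.ofReal ((2 ^ (i.1 + 1) * r / 2 ^ l) ^ p)

lemma nnnorm_rpow_le_cellCost {d : ℕ} {p r : ℝ} (hp : 0 ≤ p) (hr : 0 < r) (l : ℕ)
    (x y : Fin d → ℝ) (h : dyadicCell r l x = dyadicCell r l y) :
    (‖x - y‖₊ : ℝ≥0∞) ^ p ≤
      cellCost p r l (dyadicCell r (l + 1) x) + cellCost p r l (dyadicCell r (l + 1) y) := by
  have e : (‖x - y‖₊ : ℝ≥0∞) ^ p = ENNReal.ofReal (‖x - y‖ ^ p) := by
    rw [← ENNReal.ofReal_rpow_of_nonneg (norm_nonneg _) hp, ofReal_norm]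
    rfl
  rw [e]
  simp only [cellCost, dyadicCell]
  cases l with
  | zero =>
    have h1 := norm_le_two_pow_ringIdx hr x
    have h2 := norm_le_two_pow_ringIdx hr y
    have h3 := norm_sub_le x y
    rcases le_total (ringIdx r x) (ringIdx r y) with hle | hle
    · refine le_add_left (ENNReal.ofReal_le_ofReal (Real.rpow_le_rpow (norm_nonneg _) ?_ hp))
      have : (2 : ℝ) ^ ringIdx r x * r ≤ 2 ^ ringIdx r y * r := by gcongr; norm_num
      rw [pow_succ, pow_zero]
      linarith
    · refine le_add_right (ENNReal.ofReal_le_ofReal (Real.rpow_le_rpow (norm_nonneg _) ?_ hp))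
      have : (2 : ℝ) ^ ringIdx r y * r ≤ 2 ^ ringIdx r x * r := by gcongr; norm_num
      rw [pow_succ, pow_zero]
      linarith
  | succ l =>
    refine le_add_right (ENNReal.ofReal_le_ofReal (Real.rpow_le_rpow (norm_nonneg _) ?_ hp))
    refine (norm_sub_le_of_dyadicCell_eq hr l x y h).trans_eq ?_
    rw [pow_succ, pow_succ]
    field_simp

/-- The possible positions, inside its ring, of a nonempty cell of level `l + 1`. -/
noncomputable def cellPositions (d l : ℕ) : Finset (Fin d → ℤ) :=
  Fintype.piFinset fun _ => Finset.Icc (-2 ^ l) (2 ^ l)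

lemma card_cellPositions_le (d l : ℕ) : ((cellPositions d l).card : ℝ) ≤ (3 * 2 ^ l) ^ d := by
  have h : (cellPositions d l).card = (2 * 2 ^ l + 1) ^ d := by
    rw [cellPositions, Fintype.card_piFinset_const, Int.card_Icc]
    congr 1
    have : ((2 : ℤ) ^ l + 1 - -2 ^ l) = ((2 * 2 ^ l + 1 : ℕ) : ℤ) := by push_cast; ring
    rw [this, Int.toNat_natCast]
  rw [h]
  push_cast
  have : (1 : ℝ) ≤ 2 ^ l := one_le_pow₀ one_le_two
  gcongr
  linarith

lemma dyadicCell_preimage_eq_empty {d : ℕ} {r : ℝ} (hr : 0 < r) (l n : ℕ) (k : Fin d → ℤ)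
    (hk : k ∉ cellPositions d l) :
    (dyadicCell r (l + 1) : (Fin d → ℝ) → ℕ × (Fin d → ℤ)) ⁻¹' {(n, k)} = ∅ := by
  rw [Set.eq_empty_iff_forall_notMem]
  intro x hx
  have hx' : dyadicCell r (l + 1) x = (n, k) := hx
  refine hk ?_
  have h2 : (fun i => ⌊2 ^ l * (x i / (2 ^ ringIdx r x * r))⌋) = k := congrArg Prod.snd hx'
  rw [cellPositions, Fintype.mem_piFinset]
  intro i
  rw [← h2, Finset.mem_Icc]
  have hx1 : |x i / (2 ^ ringIdx r x * r)| ≤ 1 := by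
    rw [abs_div, abs_of_pos (by positivity : (0 : ℝ) < 2 ^ ringIdx r x * r),
      div_le_one (by positivity)]
    exact (norm_le_pi_norm x i).trans (norm_le_two_pow_ringIdx hr x)
  obtain ⟨ha, hb⟩ := abs_le.1 hx1
  have h2l : (0 : ℝ) < 2 ^ l := by positivity
  constructor
  · rw [Int.le_floor]
    push_cast
    nlinarith
  · have : ((⌊2 ^ l * (x i / (2 ^ ringIdx r x * r))⌋ : ℤ) : ℝ) ≤ ((2 ^ l : ℤ) : ℝ) := by
      refine (Int.floor_le _).trans ?_
      push_cast
      nlinarith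
    exact_mod_cast this

lemma lintegral_two_pow_ringIdx_le {d : ℕ} {q r : ℝ} (hq : 0 ≤ q) (hr : 0 < r)
    (μ : Measure (Fin d → ℝ)) [IsProbabilityMeasure μ]
    (hM : ∫⁻ x, (‖x‖₊ : ℝ≥0∞) ^ q ∂μ ≤ ENNReal.ofReal (r ^ q)) :
    ∫⁻ x, ENNReal.ofReal ((2 ^ ringIdx r x) ^ q) ∂μ ≤ ENNReal.ofReal (2 ^ q + 1) := by
  have h1 : ∀ x : Fin d → ℝ, ENNReal.ofReal ((2 ^ ringIdx r x) ^ q) ≤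
      1 + ENNReal.ofReal ((2 / r) ^ q) * (‖x‖₊ : ℝ≥0∞) ^ q := by
    intro x
    have e : (‖x‖₊ : ℝ≥0∞) ^ q = ENNReal.ofReal (‖x‖ ^ q) := by
      rw [← ENNReal.ofReal_rpow_of_nonneg (norm_nonneg _) hq, ofReal_norm]
      rfl
    rw [e, ← ENNReal.ofReal_mul (by positivity), ← Real.mul_rpow (by positivity) (by positivity),
      ← ENNReal.ofReal_one, ← ENNReal.ofReal_add (by positivity) (by positivity)]
    refine ENNReal.ofReal_le_ofReal ?_
    have h := two_pow_ringIdx_le hr x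
    rcases le_max_iff.1 h with h | h
    · have : (2 : ℝ) ^ ringIdx r x ≤ 1 := by
        by_contra! hlt
        nlinarith
      have := Real.rpow_le_rpow (by positivity) this hq
      rw [Real.one_rpow] at this
      have : 0 ≤ (2 / r * ‖x‖) ^ q := by positivity
      linarith
    · have : (2 : ℝ) ^ ringIdx r x ≤ 2 / r * ‖x‖ := by
        rw [div_mul_eq_mul_div, le_div_iff₀ hr]
        exact h
      have := Real.rpow_le_rpow (by positivity) this hq
      linarith
  calc ∫⁻ x, ENNReal.ofReal ((2 ^ ringIdx r x) ^ q) ∂μ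
      ≤ ∫⁻ x, (1 + ENNReal.ofReal ((2 / r) ^ q) * (‖x‖₊ : ℝ≥0∞) ^ q) ∂μ := lintegral_mono h1
    _ = 1 + ENNReal.ofReal ((2 / r) ^ q) * ∫⁻ x, (‖x‖₊ : ℝ≥0∞) ^ q ∂μ := by
        rw [lintegral_add_left measurable_const, lintegral_const_mul' _ _ ENNReal.ofReal_ne_top]
        simp
    _ ≤ 1 + ENNReal.ofReal ((2 / r) ^ q) * ENNReal.ofReal (r ^ q) := by gcongr
    _ = ENNReal.ofReal (2 ^ q + 1) := by
        rw [← ENNReal.ofReal_mul (by positivity), ← Real.mul_rpow (by positivity) hr.le,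
          div_mul_cancel₀ _ hr.ne', add_comm, ENNReal.ofReal_add (by positivity) zero_le_one,
          ENNReal.ofReal_one]

lemma measureReal_ringIdx_le {d : ℕ} {q r : ℝ} (hq : 0 ≤ q) (hr : 0 < r)
    (μ : Measure (Fin d → ℝ)) [IsProbabilityMeasure μ]
    (hM : ∫⁻ x, (‖x‖₊ : ℝ≥0∞) ^ q ∂μ ≤ ENNReal.ofReal (r ^ q)) (n : ℕ) :
    μ.real (ringIdx r ⁻¹' {n}) ≤ (2 ^ q + 1) * (2 ^ (-q)) ^ n := by
  have h := lintegral_two_pow_ringIdx_le hq hr μ hM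
  rw [lintegral_comp_eq_tsum_fiber (measurable_ringIdx r) μ
    (fun n : ℕ => ENNReal.ofReal (((2 : ℝ) ^ n) ^ q))] at h
  have h1 := (ENNReal.le_tsum n).trans h
  rw [← ENNReal.ofReal_toReal (measure_ne_top μ (ringIdx r ⁻¹' {n})),
    ← ENNReal.ofReal_mul (by positivity), ENNReal.ofReal_le_ofReal_iff (by positivity)] at h1
  have h2 : ((2 : ℝ) ^ n) ^ q * (2 ^ (-q)) ^ n = 1 := by
    rw [← Real.rpow_natCast, ← Real.rpow_natCast, ← Real.rpow_mul zero_le_two,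
      ← Real.rpow_mul zero_le_two, ← Real.rpow_add two_pos]
    ring_nf
    simp
  calc μ.real (ringIdx r ⁻¹' {n})
      = (((2 : ℝ) ^ n) ^ q * μ.real (ringIdx r ⁻¹' {n})) * (2 ^ (-q)) ^ n := by
        rw [mul_right_comm, h2, one_mul]
    _ ≤ (2 ^ q + 1) * (2 ^ (-q)) ^ n := by
        gcongr
        exact h1

lemma lintegral_empMeas {d N : ℕ} (x : Fin N → (Fin d → ℝ)) {g : (Fin d → ℝ) → ℝ≥0∞}
    (hg : Measurable g) : ∫⁻ y, g y ∂(empMeas N x) = (N : ℝ≥0∞)⁻¹ * ∑ j, g (x j) := by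
  rw [empMeas, lintegral_smul_measure, lintegral_finsetSum_measure]
  simp [lintegral_dirac' _ hg]

lemma empMeas_apply {d N : ℕ} (x : Fin N → (Fin d → ℝ)) {A : Set (Fin d → ℝ)}
    (hA : MeasurableSet A) :
    empMeas N x A = (N : ℝ≥0∞)⁻¹ * ∑ j, A.indicator 1 (x j) := by
  rw [← lintegral_indicator_one hA, lintegral_empMeas x (measurable_one.indicator hA)]

lemma isProbabilityMeasure_empMeas {d N : ℕ} (hN : 1 ≤ N) (x : Fin N → (Fin d → ℝ)) :
    IsProbabilityMeasure (empMeas N x) := by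
  constructor
  rw [empMeas_apply x MeasurableSet.univ]
  simp only [Set.indicator_univ, Pi.one_apply, Finset.sum_const, Finset.card_univ,
    Fintype.card_fin, nsmul_eq_mul, mul_one]
  exact ENNReal.inv_mul_cancel (by simp; omega) (by simp)

lemma measurable_empMeas_apply {d N : ℕ} {A : Set (Fin d → ℝ)} (hA : MeasurableSet A) :
    Measurable fun x : Fin N → (Fin d → ℝ) => empMeas N x A := by
  simp only [empMeas_apply _ hA]
  refine Measurable.const_mul (Finset.measurable_sum _ fun j _ => ?_) _
  exact (measurable_one.indicator hA).comp (measurable_pi_apply j)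

lemma lintegral_lintegral_empMeas {d N : ℕ} (hN : 1 ≤ N) (μ : Measure (Fin d → ℝ))
    [IsProbabilityMeasure μ] {g : (Fin d → ℝ) → ℝ≥0∞} (hg : Measurable g) :
    ∫⁻ x, ∫⁻ y, g y ∂(empMeas N x) ∂(Measure.pi fun _ : Fin N => μ) = ∫⁻ y, g y ∂μ := by
  simp only [lintegral_empMeas _ hg]
  have h1 : ∀ j : Fin N, ∫⁻ x : Fin N → (Fin d → ℝ), g (x j) ∂(Measure.pi fun _ : Fin N => μ) =
      ∫⁻ y, g y ∂μ := fun j =>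
    (measurePreserving_eval (fun _ : Fin N => μ) j).lintegral_comp hg
  have hgm : ∀ j : Fin N, Measurable fun x : Fin N → (Fin d → ℝ) => g (x j) :=
    fun j => hg.comp (measurable_pi_apply j)
  rw [lintegral_const_mul _ (Finset.measurable_sum _ fun j _ => hgm j),
    lintegral_finsetSum _ fun j _ => hgm j]
  simp only [h1, Finset.sum_const, Finset.card_univ, Fintype.card_fin, nsmul_eq_mul]
  rw [← mul_assoc, ENNReal.inv_mul_cancel (by simp; omega) (by simp), one_mul]

/-- The expected discrepancy between `μ` and its empirical measure on the set `A`. -/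
noncomputable def expDiscrepancy {d : ℕ} (μ : Measure (Fin d → ℝ)) (N : ℕ)
    (A : Set (Fin d → ℝ)) : ℝ≥0∞ :=
  ∫⁻ x, ((μ A - empMeas N x A) + (empMeas N x A - μ A)) ∂(Measure.pi fun _ : Fin N => μ)

lemma expDiscrepancy_le_two_mul {d N : ℕ} (hN : 1 ≤ N) (μ : Measure (Fin d → ℝ))
    [IsProbabilityMeasure μ] {A : Set (Fin d → ℝ)} (hA : MeasurableSet A) :
    expDiscrepancy μ N A ≤ 2 * μ A := by
  have h := lintegral_lintegral_empMeas hN μ (measurable_one.indicator hA)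
  simp only [lintegral_indicator_one hA] at h
  calc expDiscrepancy μ N A
      ≤ ∫⁻ x, (μ A + empMeas N x A) ∂(Measure.pi fun _ : Fin N => μ) :=
        lintegral_mono fun x => add_le_add tsub_le_self tsub_le_self
    _ = 2 * μ A := by
        rw [lintegral_add_left measurable_const, h]
        simp [two_mul]

lemma lintegral_empirical_sq_le {d N : ℕ} (hN : 1 ≤ N) (μ : Measure (Fin d → ℝ))
    [IsProbabilityMeasure μ] {A : Set (Fin d → ℝ)} (hA : MeasurableSet A) :
    ∫⁻ x, ENNReal.ofReal (((N : ℝ)⁻¹ * ∑ j, A.indicator 1 (x j) - μ.real A) ^ 2)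
      ∂(Measure.pi fun _ : Fin N => μ) ≤ ENNReal.ofReal (μ.real A / N) := by
  have hN0 : (N : ℝ) ≠ 0 := by positivity
  set P := Measure.pi fun _ : Fin N => μ with hP
  set I : (Fin d → ℝ) → ℝ := A.indicator 1 with hI
  have hIm : MemLp I 2 μ := memLp_indicator_const 2 hA (1 : ℝ) (Or.inr (measure_ne_top _ _))
  have hIj : ∀ j : Fin N, MemLp (fun x : Fin N → (Fin d → ℝ) => I (x j)) 2 P := fun j =>
    hIm.comp_measurePreserving (measurePreserving_eval (fun _ : Fin N => μ) j)
  have hint : ∀ j : Fin N, ∫ x, I (x j) ∂P = μ.real A := by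
    intro j
    have := integral_map (μ := P) (φ := fun x : Fin N → (Fin d → ℝ) => x j)
      (measurable_pi_apply j).aemeasurable (f := I) ?_
    · rw [← this, (measurePreserving_eval (fun _ : Fin N => μ) j).map_eq]
      exact integral_indicator_one hA
    · rw [(measurePreserving_eval (fun _ : Fin N => μ) j).map_eq]
      exact hIm.aestronglyMeasurable
  have hS : MemLp (fun x : Fin N → (Fin d → ℝ) => (N : ℝ)⁻¹ * ∑ j, I (x j)) 2 P :=
    (memLp_finsetSum _ fun j _ => hIj j).const_mul _
  have hES : ∫ x, (N : ℝ)⁻¹ * ∑ j, I (x j) ∂P = μ.real A := by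
    rw [integral_const_mul, integral_finsetSum _ fun j _ => (hIj j).integrable one_le_two]
    simp [hint, hN0]
  have hvar : ProbabilityTheory.variance
      (fun x : Fin N → (Fin d → ℝ) => (N : ℝ)⁻¹ * ∑ j, I (x j)) P ≤ μ.real A / N := by
    rw [ProbabilityTheory.variance_const_mul]
    have h1 := ProbabilityTheory.variance_sum_pi (μ := fun _ : Fin N => μ)
      (X := fun _ => I) (fun _ => hIm)
    have h2 : (∑ j : Fin N, fun x : Fin N → (Fin d → ℝ) => I (x j)) =
        fun x => ∑ j, I (x j) := by
      ext x; simp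
    rw [h2] at h1
    rw [h1]
    have h3 : ProbabilityTheory.variance I μ ≤ μ.real A := by
      refine (ProbabilityTheory.variance_le_expectation_sq hIm.aestronglyMeasurable).trans ?_
      have : (I ^ 2 : (Fin d → ℝ) → ℝ) = A.indicator 1 := by
        ext x
        by_cases hx : x ∈ A <;> simp [hI, hx]
      rw [this, integral_indicator_one hA]
    simp only [Finset.sum_const, Finset.card_univ, Fintype.card_fin, nsmul_eq_mul]
    calc ((N : ℝ)⁻¹) ^ 2 * (N * ProbabilityTheory.variance I μ)
        = ProbabilityTheory.variance I μ / N := by field_simp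
      _ ≤ μ.real A / N := by gcongr
  have h := ProbabilityTheory.evariance_eq_lintegral_ofReal
    (fun x : Fin N → (Fin d → ℝ) => (N : ℝ)⁻¹ * ∑ j, I (x j)) P
  rw [hES] at h
  rw [← h, ← hS.ofReal_variance_eq]
  exact ENNReal.ofReal_le_ofReal hvar

lemma expDiscrepancy_le {d N : ℕ} (hN : 1 ≤ N) (μ : Measure (Fin d → ℝ))
    [IsProbabilityMeasure μ] {A : Set (Fin d → ℝ)} (hA : MeasurableSet A) {t : ℝ} (ht : 0 < t) :
    expDiscrepancy μ N A ≤ ENNReal.ofReal (t + t⁻¹ * (μ.real A / N)) := by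
  have hpt : ∀ x : Fin N → (Fin d → ℝ),
      (μ A - empMeas N x A) + (empMeas N x A - μ A) ≤ ENNReal.ofReal t +
        ENNReal.ofReal t⁻¹ *
          ENNReal.ofReal (((N : ℝ)⁻¹ * ∑ j, A.indicator 1 (x j) - μ.real A) ^ 2) := by
    intro x
    set s : ℝ := (N : ℝ)⁻¹ * ∑ j, A.indicator 1 (x j) with hs
    have hind : ∀ j, (0 : ℝ) ≤ A.indicator 1 (x j) := fun j =>
      Set.indicator_nonneg (fun _ _ => zero_le_one) _
    have hs0 : 0 ≤ s := mul_nonneg (by positivity) (Finset.sum_nonneg fun j _ => hind j)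
    have hes : empMeas N x A = ENNReal.ofReal s := by
      rw [empMeas_apply x hA, hs, ENNReal.ofReal_mul (by positivity),
        ENNReal.ofReal_inv_of_pos (by positivity), ENNReal.ofReal_natCast,
        ENNReal.ofReal_sum_of_nonneg fun j _ => hind j]
      congr 2
      ext1 j
      by_cases hx : x j ∈ A <;> simp [hx]
    have hμ : μ A = ENNReal.ofReal (μ.real A) := (ENNReal.ofReal_toReal (measure_ne_top _ _)).symm
    have ha0 : 0 ≤ μ.real A := measureReal_nonneg
    rw [hes, hμ, ← ENNReal.ofReal_sub _ hs0, ← ENNReal.ofReal_sub _ ha0,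
      ← ENNReal.ofReal_mul (by positivity), ← ENNReal.ofReal_add ht.le (by positivity)]
    generalize μ.real A = a
    have hq : |s - a| ≤ t + t⁻¹ * (s - a) ^ 2 := by
      rw [← sq_abs]
      generalize |s - a| = u
      have : t * u ≤ t * (t + t⁻¹ * u ^ 2) := by
        rw [mul_add, mul_inv_cancel_left₀ ht.ne']
        nlinarith [sq_nonneg (t - u), sq_nonneg (t + u)]
      exact le_of_mul_le_mul_left this ht
    rcases le_total s a with h | h
    · rw [ENNReal.ofReal_of_nonpos (sub_nonpos.2 h), add_zero]
      refine ENNReal.ofReal_le_ofReal (le_trans ?_ hq)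
      rw [abs_sub_comm]
      exact le_abs_self _
    · rw [ENNReal.ofReal_of_nonpos (sub_nonpos.2 h), zero_add]
      exact ENNReal.ofReal_le_ofReal (le_trans (le_abs_self _) hq)
  refine (lintegral_mono hpt).trans ?_
  rw [lintegral_add_left measurable_const, lintegral_const_mul' _ _ ENNReal.ofReal_ne_top,
    ENNReal.ofReal_add ht.le (by positivity), ENNReal.ofReal_mul (by positivity)]
  simp only [lintegral_const, measure_univ, mul_one]
  gcongr
  exact lintegral_empirical_sq_le hN μ hA

/-- The expected discrepancy over all cells of one level in one ring. -/
lemma tsum_expDiscrepancy_le {d N : ℕ} (hN : 1 ≤ N) (μ : Measure (Fin d → ℝ))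
    [IsProbabilityMeasure μ] {r : ℝ} (hr : 0 < r) (l n : ℕ) :
    ∑' k : Fin d → ℤ, expDiscrepancy μ N (dyadicCell r (l + 1) ⁻¹' {(n, k)}) ≤
      ENNReal.ofReal (2 * min (μ.real (ringIdx r ⁻¹' {n}))
        (√((3 * 2 ^ l) ^ d) * √(μ.real (ringIdx r ⁻¹' {n}) / N))) := by
  have hm : ∀ k, MeasurableSet
      ((dyadicCell r (l + 1) : (Fin d → ℝ) → ℕ × (Fin d → ℤ)) ⁻¹' {(n, k)}) :=
    fun k => measurable_dyadicCell r (l + 1) (measurableSet_singleton _)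
  have hdisj : Pairwise (Function.onFun Disjoint fun k : Fin d → ℤ =>
      (dyadicCell r (l + 1) : (Fin d → ℝ) → ℕ × (Fin d → ℤ)) ⁻¹' {(n, k)}) := by
    intro i j hij
    refine Disjoint.preimage _ ?_
    simpa using hij
  have hU : (⋃ k : Fin d → ℤ,
      (dyadicCell r (l + 1) : (Fin d → ℝ) → ℕ × (Fin d → ℤ)) ⁻¹' {(n, k)}) =
      ringIdx r ⁻¹' {n} := by
    ext x
    simp [dyadicCell, Prod.ext_iff]
  have htsum : ∑' k : Fin d → ℤ, μ (dyadicCell r (l + 1) ⁻¹' {(n, k)}) =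
      μ (ringIdx r ⁻¹' {n}) := by
    rw [← hU, measure_iUnion hdisj hm]
  set m := μ.real (ringIdx r ⁻¹' {n}) with hmdef
  have hm0 : 0 ≤ m := measureReal_nonneg
  have hμm : μ (ringIdx r ⁻¹' {n}) = ENNReal.ofReal m :=
    (ENNReal.ofReal_toReal (measure_ne_top _ _)).symm
  have b1 : ∑' k : Fin d → ℤ, expDiscrepancy μ N (dyadicCell r (l + 1) ⁻¹' {(n, k)}) ≤
      ENNReal.ofReal (2 * m) := by
    refine (ENNReal.tsum_le_tsum fun k => expDiscrepancy_le_two_mul hN μ (hm k)).trans ?_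
    rw [ENNReal.tsum_mul_left, htsum, hμm, ENNReal.ofReal_mul zero_le_two]
    simp
  rw [mul_min_of_nonneg _ _ zero_le_two]
  refine (le_min b1 ?_).trans_eq (ENNReal.ofReal_mono.map_min).symm
  rcases hm0.eq_or_lt with h0 | hpos
  · rw [← h0] at b1 ⊢
    simpa using b1
  set K : ℝ := (3 * 2 ^ l) ^ d with hK
  have hK0 : 0 < K := by positivity
  have hN0 : (0 : ℝ) < N := by positivity
  set t : ℝ := √(m / N) / √K with ht
  have ht0 : 0 < t := by positivity
  have hz : ∀ k ∉ cellPositions d l,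
      expDiscrepancy μ N (dyadicCell r (l + 1) ⁻¹' {(n, k)}) = 0 := by
    intro k hk
    rw [dyadicCell_preimage_eq_empty hr l n k hk]
    simpa using expDiscrepancy_le_two_mul hN μ MeasurableSet.empty
  rw [tsum_eq_sum hz]
  have hsum : ∑ k ∈ cellPositions d l, μ.real (dyadicCell r (l + 1) ⁻¹' {(n, k)}) ≤ m := by
    rw [← measureReal_biUnion_finset (fun i _ j _ hij => hdisj hij) fun k _ => hm k]
    refine measureReal_mono ?_
    rw [← hU]
    exact Set.iUnion₂_subset fun k _ => Set.subset_iUnion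
      (fun k => (dyadicCell r (l + 1) : (Fin d → ℝ) → ℕ × (Fin d → ℤ)) ⁻¹' {(n, k)}) k
  calc ∑ k ∈ cellPositions d l, expDiscrepancy μ N (dyadicCell r (l + 1) ⁻¹' {(n, k)})
      ≤ ∑ k ∈ cellPositions d l,
        ENNReal.ofReal (t + t⁻¹ * (μ.real (dyadicCell r (l + 1) ⁻¹' {(n, k)}) / N)) :=
        Finset.sum_le_sum fun k _ => expDiscrepancy_le hN μ (hm k) ht0
    _ = ENNReal.ofReal (∑ k ∈ cellPositions d l,
        (t + t⁻¹ * (μ.real (dyadicCell r (l + 1) ⁻¹' {(n, k)}) / N))) :=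
        (ENNReal.ofReal_sum_of_nonneg fun k _ => by positivity).symm
    _ ≤ ENNReal.ofReal (2 * (√K * √(m / N))) := by
        refine ENNReal.ofReal_le_ofReal ?_
        rw [Finset.sum_add_distrib, Finset.sum_const, nsmul_eq_mul, ← Finset.mul_sum,
          ← Finset.sum_div]
        have e1 : K * t = √K * √(m / N) := by
          rw [ht]
          nth_rewrite 1 [← Real.mul_self_sqrt hK0.le]
          field_simp
        have e2 : t⁻¹ * (m / N) = √K * √(m / N) := by
          rw [ht]
          nth_rewrite 2 [← Real.mul_self_sqrt (by positivity : 0 ≤ m / N)]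
          have : √(m / N) ≠ 0 := by positivity
          field_simp
        calc ((cellPositions d l).card : ℝ) * t + t⁻¹ *
              ((∑ k ∈ cellPositions d l, μ.real (dyadicCell r (l + 1) ⁻¹' {(n, k)})) / N)
            ≤ K * t + t⁻¹ * (m / N) := by
              gcongr
              exact card_cellPositions_le d l
          _ = 2 * (√K * √(m / N)) := by rw [e1, e2]; ring

/-- The multiscale sum is dominated by the scale at which both bounds agree. -/
lemma sum_scale_min_le {d : ℕ} {p : ℝ} (hd : 0 < d) (hp : 0 < p) (hpd : 2 * p < d) :
    ∃ C : ℝ, 0 < C ∧ ∀ (m : ℝ) (N L : ℕ), 0 ≤ m → 1 ≤ N →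
      ∑ l ∈ Finset.range L, ((2 : ℝ) ^ (-p)) ^ l * min m (√((3 * 2 ^ l) ^ d) * √(m / N)) ≤
        C * (m ^ (1 - p / d) * (N : ℝ) ^ (-p / d)) := by
  have hd0 : (0 : ℝ) < d := by exact_mod_cast hd
  set a : ℝ := 2 ^ (-p) with ha
  have ha0 : 0 < a := by positivity
  have ha1 : a < 1 := Real.rpow_lt_one_of_one_lt_of_neg one_lt_two (by linarith)
  set s : ℝ := 2 ^ ((d : ℝ) / 2) with hs
  set A : ℝ := √(3 ^ d) with hA
  set b : ℝ := a * s with hb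
  have hb' : b = 2 ^ ((d : ℝ) / 2 - p) := by
    rw [hb, ha, hs, ← Real.rpow_add two_pos]; ring_nf
  have hb1 : 1 < b := by
    rw [hb']; exact Real.one_lt_rpow one_lt_two (by linarith)
  have hb0 : 0 < b := by linarith
  have hsq : ∀ l : ℕ, √((3 * 2 ^ l) ^ d) = A * s ^ l := by
    intro l
    rw [mul_pow, Real.sqrt_mul (by positivity), Real.sqrt_eq_rpow ((2 ^ l) ^ d), hs]
    congr 1
    rw [← Real.rpow_natCast, ← Real.rpow_natCast, ← Real.rpow_natCast,
      ← Real.rpow_mul zero_le_two, ← Real.rpow_mul zero_le_two, ← Real.rpow_mul zero_le_two]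
    ring_nf
  refine ⟨A * b / (b - 1) + 1 / (1 - a), ?_, ?_⟩
  · have : 0 < b - 1 := by linarith
    have : 0 < 1 - a := by linarith
    positivity
  intro m N L hm hN
  have hN0 : (0 : ℝ) < N := by positivity
  rcases hm.eq_or_lt with h0 | hm0
  · have : (0 : ℝ) ^ (1 - p / d) = 0 := Real.zero_rpow (by
      have : p / d < 1 := by rw [div_lt_one hd0]; linarith
      linarith)
    simp [← h0, this]
  set X : ℝ := N * m with hX
  have hX0 : 0 < X := by positivity
  set R : ℝ := m ^ (1 - p / d) * (N : ℝ) ^ (-p / d) with hR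
  have hR1 : m * X ^ (-p / d) = R := by
    rw [hX, hR, Real.mul_rpow hN0.le hm0.le, sub_eq_add_neg, Real.rpow_add hm0, Real.rpow_one,
      neg_div]
    ring
  have hR2 : √(m / N) * X ^ (1 / 2 - p / d) = R := by
    rw [hX, hR, Real.mul_rpow hN0.le hm0.le, Real.sqrt_eq_rpow, Real.div_rpow hm0.le hN0.le,
      div_eq_mul_inv, ← Real.rpow_neg hN0.le]
    calc m ^ (1 / 2 : ℝ) * (N : ℝ) ^ (-(1 / 2) : ℝ) *
          ((N : ℝ) ^ (1 / 2 - p / d) * m ^ (1 / 2 - p / d))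
        = (m ^ (1 / 2 : ℝ) * m ^ (1 / 2 - p / d)) *
          ((N : ℝ) ^ (-(1 / 2) : ℝ) * (N : ℝ) ^ (1 / 2 - p / d)) := by ring
      _ = _ := by
        rw [← Real.rpow_add hm0, ← Real.rpow_add hN0]
        ring_nf
  have hR0 : 0 ≤ R := by positivity
  have hex : ∃ K : ℕ, X ≤ ((2 : ℝ) ^ d) ^ K :=
    (pow_unbounded_of_one_lt X (one_lt_pow₀ _root_.one_lt_two hd.ne')).imp fun _ h => h.le
  classical
  set K := Nat.find hex with hK
  have hKX : X ≤ ((2 : ℝ) ^ d) ^ K := Nat.find_spec hex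
  have haK : a ^ K ≤ X ^ (-p / d) := by
    have : a ^ K = (((2 : ℝ) ^ d) ^ K) ^ (-p / d) := by
      rw [ha, ← Real.rpow_natCast, ← Real.rpow_natCast, ← Real.rpow_natCast,
        ← Real.rpow_mul zero_le_two, ← Real.rpow_mul zero_le_two, ← Real.rpow_mul zero_le_two]
      congr 1
      field_simp
    rw [this]
    refine Real.rpow_le_rpow_of_nonpos hX0 hKX ?_
    rw [neg_div, neg_nonpos]
    positivity
  have hlow : ∑ l ∈ Finset.range K, b ^ l * √(m / N) ≤ b / (b - 1) * R := by
    have hbm : 0 < b - 1 := by linarith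
    rw [← Finset.sum_mul, geom_sum_eq hb1.ne']
    rcases Nat.eq_zero_or_pos K with h | h
    · rw [h]
      simp only [pow_zero, sub_self, zero_div, zero_mul]
      positivity
    · obtain ⟨k, hk⟩ : ∃ k, K = k + 1 := ⟨_, (Nat.succ_pred_eq_of_pos h).symm⟩
      have hkX : ((2 : ℝ) ^ d) ^ k ≤ X := (not_le.1 (Nat.find_min hex (by omega : k < K))).le
      have hbk : b ^ k ≤ X ^ (1 / 2 - p / d) := by
        have : b ^ k = (((2 : ℝ) ^ d) ^ k) ^ (1 / 2 - p / d) := by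
          rw [hb', ← Real.rpow_natCast, ← Real.rpow_natCast, ← Real.rpow_natCast,
            ← Real.rpow_mul zero_le_two, ← Real.rpow_mul zero_le_two, ← Real.rpow_mul zero_le_two]
          congr 1
          field_simp
        rw [this]
        refine Real.rpow_le_rpow (by positivity) hkX ?_
        rw [sub_nonneg, div_le_div_iff₀ hd0 two_pos]
        linarith
      rw [hk, ← hR2, pow_succ]
      calc (b ^ k * b - 1) / (b - 1) * √(m / N)
          ≤ (X ^ (1 / 2 - p / d) * b) / (b - 1) * √(m / N) := by
            gcongr
            have : b ^ k * b ≤ X ^ (1 / 2 - p / d) * b := by gcongr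
            linarith
        _ = _ := by ring
  have hhigh : ∑ l ∈ Finset.Ico K L, a ^ l * m ≤ 1 / (1 - a) * R := by
    have : 0 < 1 - a := by linarith
    rw [← Finset.sum_mul, ← hR1]
    calc (∑ l ∈ Finset.Ico K L, a ^ l) * m ≤ a ^ K / (1 - a) * m := by
          gcongr
          exact geom_sum_Ico_le_of_lt_one ha0.le ha1
      _ ≤ X ^ (-p / d) / (1 - a) * m := by gcongr
      _ = _ := by ring
  calc ∑ l ∈ Finset.range L, a ^ l * min m (√((3 * 2 ^ l) ^ d) * √(m / N))
      ≤ ∑ l ∈ Finset.range K ∪ Finset.Ico K L,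
          a ^ l * min m (√((3 * 2 ^ l) ^ d) * √(m / N)) := by
        refine Finset.sum_le_sum_of_subset_of_nonneg ?_ fun l _ _ => by positivity
        intro l hl
        simp only [Finset.mem_range, Finset.mem_union, Finset.mem_Ico] at hl ⊢
        omega
    _ = ∑ l ∈ Finset.range K, a ^ l * min m (√((3 * 2 ^ l) ^ d) * √(m / N)) +
        ∑ l ∈ Finset.Ico K L, a ^ l * min m (√((3 * 2 ^ l) ^ d) * √(m / N)) := by
        refine Finset.sum_union ?_
        rw [Finset.disjoint_left]
        intro l hl
        simp only [Finset.mem_range, Finset.mem_Ico] at hl ⊢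
        omega
    _ ≤ ∑ l ∈ Finset.range K, A * (b ^ l * √(m / N)) + ∑ l ∈ Finset.Ico K L, a ^ l * m := by
        refine add_le_add (Finset.sum_le_sum fun l _ => ?_) (Finset.sum_le_sum fun l _ => ?_)
        · calc a ^ l * min m (√((3 * 2 ^ l) ^ d) * √(m / N))
              ≤ a ^ l * (√((3 * 2 ^ l) ^ d) * √(m / N)) := by gcongr; exact min_le_right _ _
            _ = A * (b ^ l * √(m / N)) := by rw [hsq, hb, mul_pow]; ring
        · gcongr
          exact min_le_left _ _
    _ ≤ A * (b / (b - 1) * R) + 1 / (1 - a) * R := by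
        rw [← Finset.mul_sum]
        gcongr
    _ = (A * b / (b - 1) + 1 / (1 - a)) * R := by ring

lemma expWpPow_le_hierarchical {d N : ℕ} {p r : ℝ} (hp : 0 ≤ p) (hr : 0 < r) (hN : 1 ≤ N)
    (μ : Measure (Fin d → ℝ)) [IsProbabilityMeasure μ] (L : ℕ) :
    expWpPow p μ N ≤
      2 * ∫⁻ x, cellCost p r L (dyadicCell r (L + 1) x) ∂μ +
        ∑ l ∈ Finset.range L, ∑' i, cellCost p r l i *
          expDiscrepancy μ N (dyadicCell r (l + 1) ⁻¹' {i}) := by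
  have hg : Measurable fun x : Fin d → ℝ => cellCost p r L (dyadicCell r (L + 1) x) :=
    (measurable_of_countable (cellCost p r L)).comp (measurable_dyadicCell r (L + 1))
  have hm : ∀ l i, Measurable fun x : Fin N → (Fin d → ℝ) =>
      ((μ (dyadicCell r (l + 1) ⁻¹' {i}) - empMeas N x (dyadicCell r (l + 1) ⁻¹' {i})) +
        (empMeas N x (dyadicCell r (l + 1) ⁻¹' {i}) - μ (dyadicCell r (l + 1) ⁻¹' {i}))) := by
    intro l i
    have := measurable_empMeas_apply (N := N)
      (measurable_dyadicCell (d := d) r (l + 1) (measurableSet_singleton i))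
    exact (measurable_const.sub this).add (this.sub measurable_const)
  have hm' : ∀ l, Measurable fun x : Fin N → (Fin d → ℝ) => ∑' i, cellCost p r l i *
      ((μ (dyadicCell r (l + 1) ⁻¹' {i}) - empMeas N x (dyadicCell r (l + 1) ⁻¹' {i})) +
        (empMeas N x (dyadicCell r (l + 1) ⁻¹' {i}) - μ (dyadicCell r (l + 1) ⁻¹' {i}))) :=
    fun l => Measurable.tsum fun i => (hm l i).const_mul _
  have hpt : ∀ x : Fin N → (Fin d → ℝ), WpPow p μ (empMeas N x) ≤ _ := fun x =>
    haveI := isProbabilityMeasure_empMeas hN x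
    WpPow_le_hierarchical p μ (empMeas N x) L (dyadicCell r) (cellCost p r)
      (measurable_dyadicCell r) (dyadicCell_nested r) (nnnorm_rpow_le_cellCost hp hr)
      (0, 0) (fun _ => rfl)
  refine (lintegral_mono hpt).trans_eq ?_
  rw [lintegral_add_right _ (Finset.measurable_sum _ fun l _ => hm' l),
    lintegral_add_left measurable_const, lintegral_lintegral_empMeas hN μ hg,
    lintegral_finsetSum _ fun l _ => hm' l, two_mul]
  congr 1
  · simp
  · refine Finset.sum_congr rfl fun l _ => ?_
    rw [lintegral_tsum fun i => ((hm l i).const_mul _).aemeasurable]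
    congr 1
    ext1 i
    rw [lintegral_const_mul _ (hm l i), expDiscrepancy]

lemma cell_scale_rpow {p r : ℝ} (hr : 0 < r) (n l : ℕ) :
    ((2 : ℝ) ^ (n + 1) * r / 2 ^ l) ^ p = 2 ^ p * r ^ p * (2 ^ n) ^ p * (2 ^ (-p)) ^ l := by
  have h : ((2 : ℝ) ^ (-p)) ^ l = ((2 ^ l) ^ p)⁻¹ := by
    rw [← Real.rpow_natCast, ← Real.rpow_natCast, ← Real.rpow_mul zero_le_two,
      ← Real.rpow_mul zero_le_two, ← Real.rpow_neg zero_le_two]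
    ring_nf
  rw [h, Real.div_rpow (by positivity) (by positivity), Real.mul_rpow (by positivity) hr.le,
    pow_succ, Real.mul_rpow (by positivity) zero_le_two]
  ring

lemma lintegral_cellCost_le {d N : ℕ} {p q r : ℝ} (hd : 1 ≤ d) (hp : 0 ≤ p) (hpq : p ≤ q)
    (hr : 0 < r) (hN : 1 ≤ N) (μ : Measure (Fin d → ℝ)) [IsProbabilityMeasure μ]
    (hM : ∫⁻ x, (‖x‖₊ : ℝ≥0∞) ^ q ∂μ ≤ ENNReal.ofReal (r ^ q)) :
    ∫⁻ x, cellCost p r N (dyadicCell r (N + 1) x) ∂μ ≤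
      ENNReal.ofReal (2 ^ p * (2 ^ q + 1) * (r ^ p * (N : ℝ) ^ (-p / d))) := by
  have hd0 : (1 : ℝ) ≤ d := by exact_mod_cast hd
  have hN1 : (1 : ℝ) ≤ N := by exact_mod_cast hN
  have hNp : ((2 : ℝ) ^ (-p)) ^ N ≤ (N : ℝ) ^ (-p / d) := by
    have e : ((2 : ℝ) ^ (-p)) ^ N = (2 ^ N) ^ (-p) := by
      rw [← Real.rpow_natCast, ← Real.rpow_natCast, ← Real.rpow_mul zero_le_two,
        ← Real.rpow_mul zero_le_two, mul_comm]
    have h2 : (N : ℝ) ≤ 2 ^ N := by exact_mod_cast Nat.lt_two_pow_self.le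
    rw [e]
    refine (Real.rpow_le_rpow_of_nonpos (by linarith) h2 (by linarith)).trans ?_
    refine Real.rpow_le_rpow_of_exponent_le hN1 ?_
    rw [neg_div, neg_le_neg_iff]
    exact div_le_self hp hd0
  have hpt : ∀ x : Fin d → ℝ, cellCost p r N (dyadicCell r (N + 1) x) ≤
      ENNReal.ofReal (2 ^ p * r ^ p * (N : ℝ) ^ (-p / d)) *
        ENNReal.ofReal ((2 ^ ringIdx r x) ^ q) := by
    intro x
    rw [← ENNReal.ofReal_mul (by positivity)]
    refine ENNReal.ofReal_le_ofReal ?_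
    simp only [dyadicCell]
    rw [cell_scale_rpow hr]
    have h1 : ((2 : ℝ) ^ ringIdx r x) ^ p ≤ (2 ^ ringIdx r x) ^ q :=
      Real.rpow_le_rpow_of_exponent_le (one_le_pow₀ _root_.one_le_two) hpq
    calc 2 ^ p * r ^ p * (2 ^ ringIdx r x) ^ p * ((2 : ℝ) ^ (-p)) ^ N
        ≤ 2 ^ p * r ^ p * (2 ^ ringIdx r x) ^ q * (N : ℝ) ^ (-p / d) := by gcongr
      _ = _ := by ring
  refine (lintegral_mono hpt).trans ?_
  rw [lintegral_const_mul' _ _ ENNReal.ofReal_ne_top]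
  refine (mul_le_mul_right (lintegral_two_pow_ringIdx_le (hp.trans hpq) hr μ hM) _).trans_eq ?_
  rw [← ENNReal.ofReal_mul (by positivity)]
  ring_nf

lemma exists_expWpPow_le {d : ℕ} {p q : ℝ} (hd : 0 < d) (hp : 0 < p) (hpd : 2 * p < d)
    (hq : (d : ℝ) * p / (d - p) < q) :
    ∃ C : ℝ, 0 < C ∧ ∀ (μ : Measure (Fin d → ℝ)), IsProbabilityMeasure μ →
      ∀ N : ℕ, 1 ≤ N → ∀ r : ℝ, 0 < r →
        ∫⁻ x, (‖x‖₊ : ℝ≥0∞) ^ q ∂μ ≤ ENNReal.ofReal (r ^ q) →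
        expWpPow p μ N ≤ ENNReal.ofReal (C * (r ^ p * (N : ℝ) ^ (-p / d))) := by
  obtain ⟨C, hC, hsum⟩ := sum_scale_min_le hd hp hpd
  have hd0 : (0 : ℝ) < d := by exact_mod_cast hd
  have hdp : 0 < (d : ℝ) - p := by linarith
  have hθ : 0 < 1 - p / d := by rw [sub_pos, div_lt_one hd0]; linarith
  have hpq' : p < q * (1 - p / d) := by
    rw [div_lt_iff₀ hdp] at hq
    have : p = d * p / d := by field_simp
    rw [this, show q * (1 - d * p / d / d) = q * (d - p) / d by field_simp]
    gcongr
  have hq0 : 0 < q := lt_trans (by positivity) hq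
  have hpq : p ≤ q := by
    have : 0 < p / d := by positivity
    nlinarith
  set ρ : ℝ := 2 ^ p * (2 ^ (-q)) ^ (1 - p / d) with hρ
  have hρ0 : 0 < ρ := by positivity
  have hρ1 : ρ < 1 := by
    rw [hρ, ← Real.rpow_mul zero_le_two, ← Real.rpow_add two_pos]
    exact Real.rpow_lt_one_of_one_lt_of_neg one_lt_two (by linarith)
  set B : ℝ := (2 ^ q + 1) ^ (1 - p / d) with hB
  have hB0 : 0 < B := by positivity
  have h1ρ : 0 < 1 - ρ := by linarith
  refine ⟨2 * (2 ^ p * (2 ^ q + 1)) + 2 * 2 ^ p * C * B * (1 - ρ)⁻¹, by positivity, ?_⟩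
  intro μ hμ N hN r hr hM
  have hN0 : (0 : ℝ) < N := by positivity
  set Q : ℝ := r ^ p * (N : ℝ) ^ (-p / d) with hQ
  have hQ0 : 0 < Q := by positivity
  refine (expWpPow_le_hierarchical hp.le hr hN μ N).trans ?_
  rw [add_mul, ENNReal.ofReal_add (by positivity) (by positivity)]
  refine add_le_add ?_ ?_
  · refine (mul_le_mul_right (lintegral_cellCost_le hd hp.le hpq hr hN μ hM) _).trans_eq ?_
    rw [mul_assoc 2, ENNReal.ofReal_mul zero_le_two, ENNReal.ofReal_ofNat]
  set m : ℕ → ℝ := fun n => μ.real (ringIdx r ⁻¹' {n}) with hm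
  have hm0 : ∀ n, 0 ≤ m n := fun n => measureReal_nonneg
  set T : ℕ → ℕ → ℝ := fun l n => (2 ^ (n + 1) * r / 2 ^ l) ^ p *
    (2 * min (m n) (√((3 * 2 ^ l) ^ d) * √(m n / N))) with hT
  have hT0 : ∀ l n, 0 ≤ T l n := fun l n => by
    have := hm0 n
    positivity
  have hlevel : ∀ l, ∑' i, cellCost p r l i * expDiscrepancy μ N (dyadicCell r (l + 1) ⁻¹' {i}) ≤
      ∑' n, ENNReal.ofReal (T l n) := by
    intro l
    rw [ENNReal.tsum_prod']
    refine ENNReal.tsum_le_tsum fun n => ?_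
    simp only [cellCost]
    rw [ENNReal.tsum_mul_left, hT, ENNReal.ofReal_mul (by positivity)]
    gcongr
    exact tsum_expDiscrepancy_le hN μ hr l n
  have hring : ∀ n, ∑ l ∈ Finset.range N, T l n ≤ 2 * 2 ^ p * C * B * Q * ρ ^ n := by
    intro n
    have h1 : m n ^ (1 - p / d) ≤ B * ((2 ^ (-q)) ^ (1 - p / d)) ^ n := by
      refine (Real.rpow_le_rpow (hm0 n)
        (measureReal_ringIdx_le hq0.le hr μ hM n) hθ.le).trans_eq ?_
      rw [Real.mul_rpow (by positivity) (by positivity),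
        ← Real.rpow_pow_comm (by positivity : (0 : ℝ) ≤ 2 ^ (-q))]
    have h2 : ((2 : ℝ) ^ n) ^ p = (2 ^ p) ^ n := (Real.rpow_pow_comm zero_le_two p n).symm
    calc ∑ l ∈ Finset.range N, T l n
        = 2 * 2 ^ p * r ^ p * (2 ^ p) ^ n * ∑ l ∈ Finset.range N,
          ((2 : ℝ) ^ (-p)) ^ l * min (m n) (√((3 * 2 ^ l) ^ d) * √(m n / N)) := by
          rw [Finset.mul_sum]
          refine Finset.sum_congr rfl fun l _ => ?_
          rw [hT]
          simp only
          rw [cell_scale_rpow hr, h2]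
          ring
      _ ≤ 2 * 2 ^ p * r ^ p * (2 ^ p) ^ n * (C * (m n ^ (1 - p / d) * (N : ℝ) ^ (-p / d))) := by
          gcongr
          exact hsum (m n) N N (hm0 n) hN
      _ ≤ 2 * 2 ^ p * r ^ p * (2 ^ p) ^ n *
          (C * ((B * ((2 ^ (-q)) ^ (1 - p / d)) ^ n) * (N : ℝ) ^ (-p / d))) := by
          gcongr
      _ = 2 * 2 ^ p * C * B * Q * ρ ^ n := by
          rw [hρ, hQ, mul_pow]
          ring
  calc ∑ l ∈ Finset.range N, ∑' i, cellCost p r l i *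
        expDiscrepancy μ N (dyadicCell r (l + 1) ⁻¹' {i})
      ≤ ∑ l ∈ Finset.range N, ∑' n, ENNReal.ofReal (T l n) :=
        Finset.sum_le_sum fun l _ => hlevel l
    _ = ∑' n, ENNReal.ofReal (∑ l ∈ Finset.range N, T l n) := by
        rw [← Summable.tsum_finsetSum fun _ _ => ENNReal.summable]
        congr 1
        ext1 n
        rw [ENNReal.ofReal_sum_of_nonneg fun l _ => hT0 l n]
    _ ≤ ∑' n, ENNReal.ofReal (2 * 2 ^ p * C * B * Q * ρ ^ n) :=
        ENNReal.tsum_le_tsum fun n => ENNReal.ofReal_le_ofReal (hring n)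
    _ = ENNReal.ofReal (2 * 2 ^ p * C * B * (1 - ρ)⁻¹ * Q) := by
        rw [← ENNReal.ofReal_tsum_of_nonneg (fun n => by positivity)
          ((summable_geometric_of_lt_one hρ0.le hρ1).mul_left _), tsum_mul_left,
          tsum_geometric_of_lt_one hρ0.le hρ1]
        ring_nf

/-- Pierce-type estimate: for `d ≥ 3`, `1 ≤ p < d/2` and `q > dp/(d−p)`, there is a
constant `κ ∈ (0,∞)` such that for every probability measure `μ` on `ℝ^d` and every
`N ≥ 1`, `E[ρ_p^p(μ, μ̂_N)]^{1/p} ≤ κ (∫ ‖x‖^q dμ)^{1/q} N^{−1/d}`. -/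
theorem pierce_type_estimate {d : ℕ} (hd : 3 ≤ d) (p q : ℝ)
    (hp : 1 ≤ p) (hpd : 2 * p < d) (hq : q > (d : ℝ) * p / ((d : ℝ) - p)) :
    ∃ κ : ℝ, 0 < κ ∧ ∀ μ : Measure (Fin d → ℝ), IsProbabilityMeasure μ →
      ∀ N : ℕ, 1 ≤ N →
        (expWpPow p μ N) ^ (1 / p) ≤
          ENNReal.ofReal κ * (∫⁻ x, (‖x‖₊ : ℝ≥0∞) ^ q ∂μ) ^ (1 / q) *
            (N : ℝ≥0∞) ^ (-(1 : ℝ) / d) := by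
  have hp0 : 0 < p := by linarith
  have hd0 : (0 : ℝ) < d := by linarith
  have hq0 : 0 < q := lt_trans (div_pos (by positivity) (by linarith)) hq
  obtain ⟨C, hC, hW⟩ := exists_expWpPow_le (by omega) hp0 hpd hq
  refine ⟨C ^ (1 / p), by positivity, fun μ hμ N hN => ?_⟩
  have hN0 : (0 : ℝ) < N := by positivity
  have hNe : (N : ℝ≥0∞) ^ (-(1 : ℝ) / d) = ENNReal.ofReal ((N : ℝ) ^ (-(1 : ℝ) / d)) := by
    rw [← ENNReal.ofReal_rpow_of_pos hN0, ENNReal.ofReal_natCast]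
  rw [hNe]
  have hNpos : 0 < (N : ℝ) ^ (-(1 : ℝ) / d) := by positivity
  rcases eq_or_ne (∫⁻ x, (‖x‖₊ : ℝ≥0∞) ^ q ∂μ) ∞ with hM | hM
  · rw [hM, ENNReal.top_rpow_of_pos (by positivity), ENNReal.mul_top (by simp; positivity),
      ENNReal.top_mul (by simpa using hNpos)]
    exact le_top
  set M := ∫⁻ x, (‖x‖₊ : ℝ≥0∞) ^ q ∂μ with hMdef
  have hroot : M ^ (1 / q) ≠ ∞ := ENNReal.rpow_ne_top_of_nonneg (by positivity) hM
  set R : ℝ := (M ^ (1 / q)).toReal with hR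
  have hR0 : 0 ≤ R := ENNReal.toReal_nonneg
  have hMR : M = ENNReal.ofReal (R ^ q) := by
    rw [← ENNReal.ofReal_rpow_of_nonneg hR0 hq0.le, hR, ENNReal.ofReal_toReal hroot,
      ← ENNReal.rpow_mul, one_div_mul_cancel hq0.ne', ENNReal.rpow_one]
  have hbound : ∀ r, R < r → (expWpPow p μ N) ^ (1 / p) ≤
      ENNReal.ofReal (C ^ (1 / p) * r * (N : ℝ) ^ (-(1 : ℝ) / d)) := by
    intro r hRr
    have hr : 0 < r := hR0.trans_lt hRr
    have h1 := hW μ hμ N hN r hr (by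
      rw [← hMdef, hMR]
      exact ENNReal.ofReal_le_ofReal (Real.rpow_le_rpow hR0 hRr.le hq0.le))
    refine (ENNReal.rpow_le_rpow h1 (by positivity)).trans_eq ?_
    rw [ENNReal.ofReal_rpow_of_nonneg (by positivity) (by positivity),
      Real.mul_rpow hC.le (by positivity), Real.mul_rpow (by positivity) (by positivity),
      ← Real.rpow_mul hr.le, ← Real.rpow_mul hN0.le, mul_one_div_cancel hp0.ne', Real.rpow_one,
      show -p / d * (1 / p) = -1 / d by field_simp, mul_assoc]
  have hlim : Filter.Tendsto
      (fun r : ℝ => ENNReal.ofReal (C ^ (1 / p) * r * (N : ℝ) ^ (-(1 : ℝ) / d)))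
      (nhdsWithin R (Set.Ioi R))
      (nhds (ENNReal.ofReal (C ^ (1 / p) * R * (N : ℝ) ^ (-(1 : ℝ) / d)))) := by
    have : Continuous fun r : ℝ =>
        ENNReal.ofReal (C ^ (1 / p) * r * (N : ℝ) ^ (-(1 : ℝ) / d)) :=
      ENNReal.continuous_ofReal.comp (by fun_prop)
    exact this.continuousAt.mono_left nhdsWithin_le_nhds
  refine (ge_of_tendsto hlim (Filter.eventually_of_mem self_mem_nhdsWithin hbound)).trans_eq ?_
  rw [ENNReal.ofReal_mul (by positivity), ENNReal.ofReal_mul (by positivity), hR,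
    ENNReal.ofReal_toReal hroot]
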